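/- Let K ⊆ ℝ² be a convex set containing the closed ball B(0, r_inner) of radius r_inner > 0 centered at the origin, let 0 < κ ≤ 1/10 with r_inner ≤ 1−κ, and let F be an arc of the unit circle of angular measure t with π/2 ≤ t < 2π whose two endpoints belong to K. Let F_{1−κ} = {(1−κ)z : z ∈ F}. Then the angular measure of F_{1−κ} ∩ K is at least κ · r_inner. -/

import Mathlib

open MeasureTheory Real

/-- The point `(cos θ, sin θ)` on the unit circle in `ℝ²`. -/
noncomputable def unitPt (θ : ℝ) : EuclideanSpace ℝ (Fin 2) :=
  (EuclideanSpace.equiv (Fin 2) ℝ).symm ![Real.cos θ, Real.sin θ]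

/-- The angular measure of a subset `A` of the origin-centered circle of radius `r`
in `ℝ²`: the Lebesgue measure of the set of angles `θ ∈ [0, 2π)` whose corresponding
point of the radius-`r` circle lies in `A`. -/
noncomputable def angularMeasure (r : ℝ) (A : Set (EuclideanSpace ℝ (Fin 2))) : ℝ :=
  (volume {θ : ℝ | θ ∈ Set.Ico 0 (2 * Real.pi) ∧ r • unitPt θ ∈ A}).toReal

lemma unitPt_periodic : Function.Periodic unitPt (2 * Real.pi) := by
  intro θ
  simp [unitPt]

/-- A convex set containing `x` and the ball of radius `r` around `0` contains every `q` with
`‖q - l • x‖ ≤ (1 - l) * r` for some `0 ≤ l < 1`. -/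
lemma Convex.mem_of_norm_sub_smul_le {E : Type*} [NormedAddCommGroup E] [NormedSpace ℝ E]
    {K : Set E} (hK : Convex ℝ K) {r l : ℝ} (hball : Metric.closedBall (0 : E) r ⊆ K)
    {x q : E} (hx : x ∈ K) (hl₀ : 0 ≤ l) (hl₁ : l < 1) (h : ‖q - l • x‖ ≤ (1 - l) * r) :
    q ∈ K := by
  have hl : 0 < 1 - l := by linarith
  have hb : (1 - l)⁻¹ • (q - l • x) ∈ K := by
    apply hball
    rw [mem_closedBall_zero_iff, norm_smul, Real.norm_of_nonneg (inv_nonneg.2 hl.le),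
      inv_mul_le_iff₀ hl]
    exact h
  have hmem := hK hx hb hl₀ hl.le (by ring)
  rwa [smul_inv_smul₀ hl.ne', add_sub_cancel] at hmem

lemma norm_smul_unitPt_sub_sq (ρ l θ δ : ℝ) :
    ‖ρ • unitPt (θ + δ) - l • unitPt θ‖ ^ 2 = ρ ^ 2 - 2 * ρ * l * Real.cos δ + l ^ 2 := by
  have hδ : Real.cos δ =
      Real.cos (θ + δ) * Real.cos θ + Real.sin (θ + δ) * Real.sin θ := by
    rw [← Real.cos_sub, add_sub_cancel_left]
  rw [EuclideanSpace.norm_sq_eq, Fin.sum_univ_two, hδ]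
  simp only [unitPt, PiLp.sub_apply, PiLp.smul_apply, smul_eq_mul, Real.norm_eq_abs, sq_abs,
    PiLp.continuousLinearEquiv_symm_apply, EuclideanSpace.equiv, Matrix.cons_val_zero,
    Matrix.cons_val_one]
  linear_combination ρ ^ 2 * Real.sin_sq_add_cos_sq (θ + δ) + l ^ 2 * Real.sin_sq_add_cos_sq θ

/-- Rotating the radial contraction of a boundary point by an angle of at most `κ * r` stays in
the convex hull of that point and the ball of radius `r`. -/
lemma smul_unitPt_add_mem {K : Set (EuclideanSpace ℝ (Fin 2))} {r κ θ δ : ℝ}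
    (hK : Convex ℝ K) (hr : 0 < r)
    (hball : Metric.closedBall (0 : EuclideanSpace ℝ (Fin 2)) r ⊆ K)
    (hκ : 0 < κ) (hrκ : r ≤ 1 - κ) (hθ : unitPt θ ∈ K) (hδ₀ : 0 ≤ δ) (hδ : δ ≤ κ * r) :
    (1 - κ) • unitPt (θ + δ) ∈ K := by
  have hr₁ : r < 1 := by linarith
  have hκ₁ : κ < 1 := by linarith
  have hd : 0 < 1 - r ^ 2 := by nlinarith
  have hr2 : r ^ 2 ≤ (1 - κ) ^ 2 := by gcongr
  set c := Real.cos δ with hc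
  have hc₁ : c ≤ 1 := Real.cos_le_one δ
  have hδ2 : δ ^ 2 ≤ κ ^ 2 * r ^ 2 := by
    rw [← mul_pow]
    gcongr
  have hc₂ : 1 - κ ^ 2 * r ^ 2 / 2 ≤ c := by
    linarith [Real.one_sub_sq_div_two_le_cos (x := δ)]
  have hρc : (1 - κ) - (1 - κ) * (κ ^ 2 * r ^ 2 / 2) ≤ (1 - κ) * c := by nlinarith
  have hsmall : κ ^ 2 * r ^ 2 ≤ κ := by
    have : κ ^ 2 * r ^ 2 ≤ κ ^ 2 * 1 := by gcongr; nlinarith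
    nlinarith
  have hnum₀ : 0 ≤ (1 - κ) - r ^ 2 - (1 - κ) * (κ ^ 2 * r ^ 2 / 2) := by
    nlinarith
  have hnum : (1 - κ) - r ^ 2 - (1 - κ) * (κ ^ 2 * r ^ 2 / 2) ≤ (1 - κ) * c - r ^ 2 := by
    linarith
  have hdisc : (1 - r ^ 2) * ((1 - κ) ^ 2 - r ^ 2) ≤ ((1 - κ) * c - r ^ 2) ^ 2 := by
    refine le_trans ?_ (pow_le_pow_left₀ hnum₀ hnum 2)
    have hkey : ((1 - κ) - r ^ 2) * (1 - κ) ≤ 1 := by nlinarith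
    have hmul := mul_le_mul_of_nonneg_left hkey (by positivity : 0 ≤ κ ^ 2 * r ^ 2)
    nlinarith [sq_nonneg ((1 - κ) * (κ ^ 2 * r ^ 2 / 2))]
  have hnumer : 0 ≤ (1 - κ) * c - r ^ 2 := hnum₀.trans hnum
  set l := ((1 - κ) * c - r ^ 2) / (1 - r ^ 2) with hl
  have hlmul : l * (1 - r ^ 2) = (1 - κ) * c - r ^ 2 := div_mul_cancel₀ _ hd.ne'
  have hl₁ : l < 1 := by
    rw [hl, div_lt_one hd]
    nlinarith
  refine hK.mem_of_norm_sub_smul_le hball hθ (div_nonneg hnumer hd.le) hl₁ ?_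
  refine le_of_sq_le_sq ?_ (mul_nonneg (by linarith) hr.le)
  rw [norm_smul_unitPt_sub_sq, ← hc]
  have hfac : (1 - r ^ 2) *
      (((1 - l) * r) ^ 2 - ((1 - κ) ^ 2 - 2 * (1 - κ) * l * c + l ^ 2)) =
      ((1 - κ) * c - r ^ 2) ^ 2 - (1 - r ^ 2) * ((1 - κ) ^ 2 - r ^ 2) := by
    linear_combination (2 * ((1 - κ) * c - r ^ 2) - l * (1 - r ^ 2) -
      ((1 - κ) * c - r ^ 2)) * hlmul
  have := nonneg_of_mul_nonneg_right (hfac.symm ▸ sub_nonneg.2 hdisc) hd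
  linarith

/-- A periodic set of reals containing an interval of length `c` at most the period `T` meets
`[0, T)` in measure at least `c`. -/
lemma Function.Periodic.ofReal_le_volume_Ico {P : ℝ → Prop} {T a c : ℝ}
    (hP : Function.Periodic P T) (hT : 0 < T) (hcT : c ≤ T)
    (h : ∀ x ∈ Set.Icc a (a + c), P x) :
    ENNReal.ofReal c ≤ volume {x : ℝ | x ∈ Set.Ico 0 T ∧ P x} := by
  obtain ⟨b, ⟨hb₀, hbT⟩, h⟩ : ∃ b ∈ Set.Ico 0 T, ∀ x ∈ Set.Icc b (b + c), P x := by
    refine ⟨toIcoMod hT 0 a, by simpa using toIcoMod_mem_Ico hT 0 a, fun x hx => ?_⟩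
    rw [← hP.zsmul (toIcoDiv hT 0 a) x]
    apply h
    have := toIcoMod_add_toIcoDiv_zsmul hT 0 a
    constructor <;> linarith [hx.1, hx.2]
  by_cases hbc : b + c ≤ T
  · calc ENNReal.ofReal c = volume (Set.Ico b (b + c)) := by simp
      _ ≤ _ := by
          refine measure_mono fun x hx => ?_
          exact ⟨⟨hb₀.trans hx.1, hx.2.trans_le hbc⟩, h x ⟨hx.1, hx.2.le⟩⟩
  · push Not at hbc
    have hdisj : Disjoint (Set.Ico b T) (Set.Ico 0 (b + c - T)) := by
      rw [Set.disjoint_left]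
      intro x hx hx'
      linarith [hx.1, hx'.2]
    calc ENNReal.ofReal c = volume (Set.Ico b T ∪ Set.Ico 0 (b + c - T)) := by
          rw [measure_union hdisj measurableSet_Ico, Real.volume_Ico, Real.volume_Ico,
            ← ENNReal.ofReal_add (by linarith) (by linarith)]
          congr 1
          ring
      _ ≤ _ := by
          refine measure_mono ?_
          rintro x (hx | hx)
          · exact ⟨⟨hb₀.trans hx.1, hx.2⟩, h x ⟨hx.1, by linarith [hx.2]⟩⟩
          · refine ⟨⟨hx.1, by linarith [hx.2]⟩, ?_⟩
            rw [← hP x]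
            exact h _ ⟨by linarith [hx.1], by linarith [hx.2]⟩

/-- Claim 5.4 of the paper: if `K ⊆ ℝ²` is convex and contains the closed ball of
radius `r_inner > 0` around the origin, and `F` is an arc of the unit circle of
angular measure `t ∈ [π/2, 2π)` whose endpoints lie in `K`, then the radial
contraction `F_{1-κ}` of `F` meets `K` in angular measure at least `κ · r_inner`. -/
theorem arc_contraction_gain_ball :
    ∀ (K : Set (EuclideanSpace ℝ (Fin 2))) (rinner κ t θ₀ : ℝ),
      Convex ℝ K →
      0 < rinner →
      Metric.closedBall (0 : EuclideanSpace ℝ (Fin 2)) rinner ⊆ K →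
      0 < κ → κ ≤ 1 / 10 → rinner ≤ 1 - κ →
      Real.pi / 2 ≤ t → t < 2 * Real.pi →
      unitPt θ₀ ∈ K → unitPt (θ₀ + t) ∈ K →
      κ * rinner ≤
        angularMeasure (1 - κ)
          (((fun z => (1 - κ) • z) '' (unitPt '' Set.Icc θ₀ (θ₀ + t))) ∩ K) := by
  intro K r κ t θ₀ hK hr hball hκ hκ' hrκ ht _ hθ _
  have hκr : κ * r ≤ 1 / 10 := by nlinarith
  have hpi := Real.pi_gt_three
  have hP : Function.Periodic (fun θ => (1 - κ) • unitPt θ ∈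
      ((fun z => (1 - κ) • z) '' (unitPt '' Set.Icc θ₀ (θ₀ + t))) ∩ K) (2 * Real.pi) := by
    intro θ
    simp only [unitPt_periodic θ]
  have hle := hP.ofReal_le_volume_Ico (a := θ₀) (c := κ * r) (by linarith) (by linarith)
    fun θ hmem => by
      refine ⟨⟨unitPt θ, ⟨θ, ⟨hmem.1, by linarith [hmem.2]⟩, rfl⟩, rfl⟩, ?_⟩
      have := smul_unitPt_add_mem (δ := θ - θ₀) hK hr hball hκ hrκ hθ
        (by linarith [hmem.1]) (by linarith [hmem.2])
      rwa [add_sub_cancel] at this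
  refine (ENNReal.ofReal_le_iff_le_toReal (ne_top_of_le_ne_top ?_
    (measure_mono fun θ (h : θ ∈ Set.Ico 0 (2 * Real.pi) ∧ _) => h.1))).1 hle
  exact measure_Ico_lt_top.ne
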